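/- Suppose the generalized periodic discrete Toda equations hold for all n, t ∈ ℤ: I^{t+M}_n + V^{t+1}_{n−1} = I^t_n + V^t_n and V^{t+1}_n · I^{t+M}_n = I^t_{n+1} · V^t_n. Then the characteristic polynomial of X_t(y) is a conserved quantity: for every t ∈ ℤ, every x ∈ ℂ, and every y ∈ ℂ∖{0}, det(X_{t+1}(y) − x·E) = det(X_t(y) − x·E), where E is the N×N identity matrix. -/

import Mathlib

/-- The matrix `L_t(y)` of the periodic discrete Toda equation:
`(L)_{n,n} = 1`, `(L)_{n+1,n} = V_n` for `1 ≤ n ≤ N-1`, `(L)_{1,N} = V_N / y`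
(indices written 1-based; here `Fin N` is 0-based). -/
noncomputable def Lmat (N : ℕ) (V : ℤ → ℂ) (y : ℂ) : Matrix (Fin N) (Fin N) ℂ :=
  fun i j =>
    if (i : ℕ) = (j : ℕ) then 1
    else if (i : ℕ) = (j : ℕ) + 1 then V ((j : ℕ) + 1)
    else if (i : ℕ) = 0 ∧ (j : ℕ) = N - 1 then V N * y⁻¹
    else 0

/-- The matrix `R_t(y)` of the periodic discrete Toda equation:
`(R)_{n,n} = I_n`, `(R)_{n,n+1} = 1` for `1 ≤ n ≤ N-1`, `(R)_{N,1} = y`. -/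
noncomputable def Rmat (N : ℕ) (I : ℤ → ℂ) (y : ℂ) : Matrix (Fin N) (Fin N) ℂ :=
  fun i j =>
    if (i : ℕ) = (j : ℕ) then I ((i : ℕ) + 1)
    else if (j : ℕ) = (i : ℕ) + 1 then 1
    else if (i : ℕ) = N - 1 ∧ (j : ℕ) = 0 then y
    else 0

/-- `Rprod N I t y k = R_{t+k-1}(y) ⋯ R_{t+1}(y) R_t(y)`. -/
noncomputable def Rprod (N : ℕ) (I : ℤ → ℤ → ℂ) (t : ℤ) (y : ℂ) : ℕ → Matrix (Fin N) (Fin N) ℂ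
  | 0 => 1
  | k + 1 => Rmat N (I (t + k)) y * Rprod N I t y k

/-- `X_t(y) = L_t(y) R_{t+M-1}(y) ⋯ R_{t+1}(y) R_t(y)`. -/
noncomputable def Xmat (N M : ℕ) (I V : ℤ → ℤ → ℂ) (t : ℤ) (y : ℂ) : Matrix (Fin N) (Fin N) ℂ :=
  Lmat N (V t) y * Rprod N I t y M

def scF (N : ℕ) (i : Fin N) : Fin N :=
  if h : (i : ℕ) + 1 < N then ⟨i + 1, h⟩ else ⟨0, by have := i.2; omega⟩

def pdF (N : ℕ) (i : Fin N) : Fin N :=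
  if (i : ℕ) = 0 then ⟨N - 1, by have := i.2; omega⟩ else ⟨i - 1, by have := i.2; omega⟩

noncomputable def cF (N : ℕ) (V : ℤ → ℂ) (y : ℂ) (i : Fin N) : ℂ :=
  if (i : ℕ) = 0 then V N * y⁻¹ else V (i : ℕ)

noncomputable def wF (N : ℕ) (y : ℂ) (i : Fin N) : ℂ :=
  if (i : ℕ) + 1 = N then y else 1

theorem scF_pdF (N : ℕ) (i : Fin N) : scF N (pdF N i) = i := by
  have := i.2
  apply Fin.ext
  by_cases h : (i : ℕ) = 0
  · have h' : ¬ (N - 1 + 1 < N) := by omega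
    simp [scF, pdF, h, h']
  · have h' : (i : ℕ) - 1 + 1 < N := by omega
    simp [scF, pdF, h, h']
    omega

theorem pdF_scF (N : ℕ) (i : Fin N) : pdF N (scF N i) = i := by
  have := i.2
  apply Fin.ext
  unfold scF pdF
  split_ifs <;> simp_all <;> omega

theorem Lmat_eq (N : ℕ) (hN : 2 ≤ N) (V : ℤ → ℂ) (y : ℂ) (i j : Fin N) :
    Lmat N V y i j = (if i = j then 1 else 0) + (if pdF N i = j then cF N V y i else 0) := by
  have hi := i.2
  have hj := j.2
  unfold Lmat
  by_cases h0 : (i : ℕ) = 0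
  · have hp : pdF N i = j ↔ (j : ℕ) = N - 1 := by
      simp only [pdF, h0, if_true, Fin.ext_iff]; omega
    simp only [hp, cF, h0, if_true, Fin.ext_iff]
    split_ifs <;> first | omega | (exfalso; simp_all; done) | simp
  · have hp : pdF N i = j ↔ (i : ℕ) = j + 1 := by
      simp only [pdF, h0, if_false, Fin.ext_iff]; omega
    simp only [hp, cF, h0, if_false, Fin.ext_iff]
    split_ifs with h1 h2 h3 <;> first | omega | simp_all

theorem Rmat_eq (N : ℕ) (hN : 2 ≤ N) (I : ℤ → ℂ) (y : ℂ) (i j : Fin N) :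
    Rmat N I y i j = (if i = j then I ((i : ℕ) + 1) else 0)
      + (if scF N i = j then wF N y i else 0) := by
  have hi := i.2
  have hj := j.2
  unfold Rmat
  by_cases h0 : (i : ℕ) + 1 < N
  · have hp : scF N i = j ↔ (j : ℕ) = i + 1 := by
      simp only [scF, h0, dif_pos, Fin.ext_iff]; omega
    have hw : ¬ ((i : ℕ) + 1 = N) := by omega
    simp only [hp, wF, hw, if_false, Fin.ext_iff]
    split_ifs <;> first | omega | simp
  · have hp : scF N i = j ↔ (j : ℕ) = 0 := by
      simp only [scF, h0, dif_neg, not_false_eq_true, Fin.ext_iff]; omega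
    have hw : (i : ℕ) + 1 = N := by omega
    simp only [hp, wF, hw, if_true, Fin.ext_iff]
    split_ifs <;> first | omega | simp

theorem lax (N : ℕ) (hN : 2 ≤ N) (I0 I1 V0 V1 : ℤ → ℂ)
    (hI0 : ∀ n : ℤ, I0 (n + N) = I0 n) (hV1 : ∀ n : ℤ, V1 (n + N) = V1 n)
    (hI1 : ∀ n : ℤ, I1 (n + N) = I1 n)
    (h1 : ∀ n : ℤ, I1 n + V1 (n - 1) = I0 n + V0 n)
    (h2 : ∀ n : ℤ, V1 n * I1 n = I0 (n + 1) * V0 n) (y : ℂ) (hy : y ≠ 0) :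
    Lmat N V1 y * Rmat N I1 y = Rmat N I0 y * Lmat N V0 y := by
  ext i j
  have hi := i.2
  rw [Matrix.mul_apply, Matrix.mul_apply]
  simp only [Lmat_eq N hN, Rmat_eq N hN _ _ i, add_mul, Finset.sum_add_distrib, ite_mul, zero_mul,
    Finset.sum_ite_eq, Finset.mem_univ, if_true]
  rw [Rmat_eq N hN _ _ (pdF N i), scF_pdF, pdF_scF]
  have e1 : I1 ((i : ℕ) + 1) + cF N V1 y i * wF N y (pdF N i)
      = I0 ((i : ℕ) + 1) + wF N y i * cF N V0 y (scF N i) := by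
    have a1 : cF N V1 y i * wF N y (pdF N i) = V1 (i : ℕ) := by
      by_cases h0 : (i : ℕ) = 0
      · have := hV1 0
        have hw : N - 1 + 1 = N := by omega
        simp only [zero_add] at this
        simp [cF, wF, pdF, h0, hw, this, hy]
      · have hw : ¬ ((i : ℕ) - 1 + 1 = N) := by omega
        simp [cF, wF, pdF, h0, hw]
    have a2 : wF N y i * cF N V0 y (scF N i) = V0 ((i : ℕ) + 1) := by
      by_cases h0 : (i : ℕ) + 1 < N
      · have hw : ¬ ((i : ℕ) + 1 = N) := by omega
        simp [cF, wF, scF, h0, hw]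
      · have hw : (i : ℕ) + 1 = N := by omega
        have hz : ((i : ℕ) : ℤ) + 1 = N := by exact_mod_cast hw
        simp [cF, wF, scF, hw, hz]
        field_simp
    rw [a1, a2]
    have := h1 ((i : ℕ) + 1)
    simpa using this
  have e2 : cF N V1 y i * I1 ((pdF N i : ℕ) + 1) = I0 ((i : ℕ) + 1) * cF N V0 y i := by
    by_cases h0 : (i : ℕ) = 0
    · have hz : ((N - 1 : ℕ) : ℤ) + 1 = N := by omega
      have h3 := h2 N
      have h4 := hI0 1
      rw [add_comm] at h4
      simp only [cF, pdF, h0, if_true, hz]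
      simp only [Nat.cast_zero, zero_add]
      rw [h4] at h3
      linear_combination y⁻¹ * h3
    · have hz : (((i : ℕ) - 1 : ℕ) : ℤ) + 1 = (i : ℕ) := by omega
      simp only [cF, pdF, h0, if_false, hz]
      exact h2 _
  split_ifs <;> first | linear_combination e1 + e2 | linear_combination e1 | linear_combination e2 | ring

theorem Rprod_succ' (N : ℕ) (I : ℤ → ℤ → ℂ) (t : ℤ) (y : ℂ) (k : ℕ) :
    Rprod N I t y (k + 1) = Rprod N I (t + 1) y k * Rmat N (I t) y := by
  induction k with
  | zero => simp [Rprod]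
  | succ k ih =>
    rw [Rprod, ih, Rprod, Matrix.mul_assoc]
    have e : t + ((k + 1 : ℕ) : ℤ) = t + 1 + k := by push_cast; ring
    rw [e]

theorem det_sub_comm {N : ℕ} (A B : Matrix (Fin N) (Fin N) ℂ) (x : ℂ) :
    (A * B - x • (1 : Matrix (Fin N) (Fin N) ℂ)).det =
      (B * A - x • (1 : Matrix (Fin N) (Fin N) ℂ)).det := by
  have h := congrArg (Polynomial.eval x) (Matrix.charpoly_mul_comm A B)
  rw [Matrix.eval_charpoly, Matrix.eval_charpoly] at h
  rw [← neg_sub, Matrix.det_neg, ← neg_sub (x • 1) (B * A), Matrix.det_neg]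
  simp only [Matrix.smul_one_eq_diagonal]
  simp only [Matrix.scalar_apply] at h
  rw [h]

/-- if the generalized periodic discrete Toda equations hold for all `n, t ∈ ℤ`,
then the characteristic polynomial of `X_t(y)` is conserved:
`det (X_{t+1}(y) - x E) = det (X_t(y) - x E)` for every `t`, every `x`, and every `y ≠ 0`. -/
theorem char_poly_conserved (N M : ℕ) (hN : 2 ≤ N) (hM : 1 ≤ M)
    (I V : ℤ → ℤ → ℂ)
    (hI : ∀ t n : ℤ, I t (n + N) = I t n) (hV : ∀ t n : ℤ, V t (n + N) = V t n)
    (htoda : ∀ n t : ℤ, I (t + M) n + V (t + 1) (n - 1) = I t n + V t n ∧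
        V (t + 1) n * I (t + M) n = I t (n + 1) * V t n) :
    ∀ t : ℤ, ∀ x : ℂ, ∀ y : ℂ, y ≠ 0 →
      (Xmat N M I V (t + 1) y - x • (1 : Matrix (Fin N) (Fin N) ℂ)).det =
        (Xmat N M I V t y - x • (1 : Matrix (Fin N) (Fin N) ℂ)).det := by
  intro t x y hy
  obtain ⟨k, rfl⟩ : ∃ k, M = k + 1 := ⟨M - 1, by omega⟩
  have hl := lax N hN (I t) (I (t + (k + 1 : ℕ))) (V t) (V (t + 1)) (hI t) (hV _) (hI _)
    (fun n => (htoda n t).1) (fun n => (htoda n t).2) y hy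
  have e : t + 1 + (k : ℤ) = t + (k + 1 : ℕ) := by push_cast; ring
  have h1 : Xmat N (k + 1) I V (t + 1) y
      = Rmat N (I t) y * (Lmat N (V t) y * Rprod N I (t + 1) y k) := by
    rw [Xmat, Rprod, e, ← Matrix.mul_assoc, hl, Matrix.mul_assoc]
  have h2 : Xmat N (k + 1) I V t y
      = (Lmat N (V t) y * Rprod N I (t + 1) y k) * Rmat N (I t) y := by
    rw [Xmat, Rprod_succ', Matrix.mul_assoc]
  rw [h1, h2, det_sub_comm]
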